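/- Let f : (0,∞) → ℝ be a twice continuously differentiable function with strictly positive second derivative. The two-variable function G(ρ,σ) = −Tr f(ρ+σ) + Tr f(ρ) + Tr f(σ) is convex in positive definite operators ρ, σ if and only if Tr (a+b)* df'(ρ+σ) (a+b) ≤ Tr a* df'(ρ) a + Tr b* df'(σ) b for all positive definite ρ, σ and all operators a, b on the same finite-dimensional Hilbert space. -/

import Mathlib

open scoped Matrix
open Matrix
open scoped ComplexOrder

noncomputable section

/-- The trace of `f` applied (by the functional calculus) to a Hermitian matrix,
computed via the eigenvalues.  Junk value `0` on non-Hermitian matrices. -/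
def trFn (f : ℝ → ℝ) {d : Type} [Fintype d] [DecidableEq d] (ρ : Matrix d d ℂ) : ℝ :=
  if hρ : ρ.IsHermitian then ∑ i, f (hρ.eigenvalues i) else 0

/-- `f` applied to a Hermitian matrix by the functional calculus (spectral theorem).
Junk value `0` on non-Hermitian matrices. -/
def matFn (f : ℝ → ℝ) {d : Type} [Fintype d] [DecidableEq d] (ρ : Matrix d d ℂ) :
    Matrix d d ℂ :=
  if hρ : ρ.IsHermitian then
    (hρ.eigenvectorUnitary : Matrix d d ℂ) *
      Matrix.diagonal (fun i => (f (hρ.eigenvalues i) : ℂ)) *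
      star (hρ.eigenvectorUnitary : Matrix d d ℂ)
  else 0

/-- The partial trace over the second factor of a bipartite system `H₁ ⊗ H₂`,
where operators on `H₁ ⊗ H₂` are modelled as matrices indexed by `Fin m × Fin n`. -/
def partialTrace {m n : ℕ} (ρ : Matrix (Fin m × Fin n) (Fin m × Fin n) ℂ) :
    Matrix (Fin m) (Fin m) ℂ :=
  Matrix.of fun i j => ∑ k : Fin n, ρ (i, k) (j, k)

/-- A convex function `f : (0,∞) → ℝ` is entropic if on every finite-dimensional
bipartite system the map `ρ ↦ -Tr f(ρ₁) + Tr f(ρ)` is convex in positive definite `ρ`,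
where `ρ₁` is the partial trace of `ρ` on the first factor. -/
def IsEntropic (f : ℝ → ℝ) : Prop :=
  ConvexOn ℝ (Set.Ioi (0 : ℝ)) f ∧
  ∀ m n : ℕ,
    ConvexOn ℝ {ρ : Matrix (Fin m × Fin n) (Fin m × Fin n) ℂ | ρ.PosDef}
      (fun ρ => - trFn f (partialTrace ρ) + trFn f ρ)

/-- A convex function `f : (0,∞) → ℝ` is subentropic of order `k` if
`G(ρ₁,…,ρ_k) = -Tr f(ρ₁+⋯+ρ_k) + Tr f(ρ₁) + ⋯ + Tr f(ρ_k)` is convex in `k`-tuples of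
positive definite operators on any finite-dimensional Hilbert space. -/
def SubentropicOfOrder (f : ℝ → ℝ) (k : ℕ) : Prop :=
  ConvexOn ℝ (Set.Ioi (0 : ℝ)) f ∧
  ∀ n : ℕ,
    ConvexOn ℝ {ρ : Fin k → Matrix (Fin n) (Fin n) ℂ | ∀ i, (ρ i).PosDef}
      (fun ρ => - trFn f (∑ i, ρ i) + ∑ i, trFn f (ρ i))

/-- A function is subentropic if it is subentropic of all orders. -/
def Subentropic (f : ℝ → ℝ) : Prop :=
  ∀ k : ℕ, SubentropicOfOrder f k

/-- Divided difference of `g`, with `g'` on the diagonal. -/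
def divDiff (g : ℝ → ℝ) (x y : ℝ) : ℝ :=
  if x = y then deriv g x else (g x - g y) / (x - y)

/-- Conjugation `h ↦ U * h * U*` as a linear operator on matrices. -/
def conjEnd {n : ℕ} (U : Matrix (Fin n) (Fin n) ℂ) :
    Module.End ℂ (Matrix (Fin n) (Fin n) ℂ) :=
  (LinearMap.mulLeft ℂ U).comp (LinearMap.mulRight ℂ (star U))

/-- Hadamard (entrywise) multiplication by a fixed matrix `L`, as a linear operator. -/
def hadamardEnd {n : ℕ} (L : Matrix (Fin n) (Fin n) ℂ) :
    Module.End ℂ (Matrix (Fin n) (Fin n) ℂ) where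
  toFun h := L ⊙ h
  map_add' h₁ h₂ := Matrix.hadamard_add L h₁ h₂
  map_smul' c h := Matrix.hadamard_smul L h c

/-- The Fréchet differential `dg(ρ)` of the matrix function induced by `g` at the
Hermitian matrix `ρ`: in a basis diagonalising `ρ` it acts as the Hadamard product
with the Löwner matrix of divided differences of `g`.  Junk value `0` at
non-Hermitian matrices. -/
def frechetDiff (g : ℝ → ℝ) {n : ℕ} (ρ : Matrix (Fin n) (Fin n) ℂ) :
    Module.End ℂ (Matrix (Fin n) (Fin n) ℂ) :=
  if hρ : ρ.IsHermitian then
    (conjEnd (hρ.eigenvectorUnitary : Matrix (Fin n) (Fin n) ℂ)).comp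
      ((hadamardEnd (Matrix.of fun i j =>
          (divDiff g (hρ.eigenvalues i) (hρ.eigenvalues j) : ℂ))).comp
        (conjEnd (star (hρ.eigenvectorUnitary : Matrix (Fin n) (Fin n) ℂ))))
  else 0

/-- The order, with respect to the trace inner product, between operators on `B(H)`:
`T ≤ S` iff `S - T` is a positive superoperator. -/
def endLE {n : ℕ} (T S : Module.End ℂ (Matrix (Fin n) (Fin n) ℂ)) : Prop :=
  ∀ h : Matrix (Fin n) (Fin n) ℂ, 0 ≤ Matrix.trace (star h * (S h - T h))

/-- The harmonic mean `H₂(A,B) = 2 (A⁻¹ + B⁻¹)⁻¹` of two (positive definite, hence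
invertible) operators on `B(H)`. -/
def harmonicMeanEnd {n : ℕ} (A B : Module.End ℂ (Matrix (Fin n) (Fin n) ℂ)) :
    Module.End ℂ (Matrix (Fin n) (Fin n) ℂ) :=
  (2 : ℂ) • Ring.inverse (Ring.inverse A + Ring.inverse B)

/-- The amplification `id_n ⊗ Φ` of a linear map on matrices. -/
def amplify {m k : ℕ} (Φ : Matrix (Fin m) (Fin m) ℂ →ₗ[ℂ] Matrix (Fin k) (Fin k) ℂ)
    (n : ℕ) (A : Matrix (Fin n × Fin m) (Fin n × Fin m) ℂ) :
    Matrix (Fin n × Fin k) (Fin n × Fin k) ℂ :=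
  Matrix.of fun p q => Φ (Matrix.of fun x y => A (p.1, x) (q.1, y)) p.2 q.2

/-- A linear map on matrices is completely positive if all its amplifications
preserve positive semidefiniteness. -/
def IsCompletelyPositive {m k : ℕ}
    (Φ : Matrix (Fin m) (Fin m) ℂ →ₗ[ℂ] Matrix (Fin k) (Fin k) ℂ) : Prop :=
  ∀ n : ℕ, ∀ A : Matrix (Fin n × Fin m) (Fin n × Fin m) ℂ,
    A.PosSemidef → (amplify Φ n A).PosSemidef

/-- A quantum channel is a completely positive trace preserving linear map. -/
def IsQuantumChannel {m k : ℕ}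
    (Φ : Matrix (Fin m) (Fin m) ℂ →ₗ[ℂ] Matrix (Fin k) (Fin k) ℂ) : Prop :=
  IsCompletelyPositive Φ ∧ ∀ A, (Φ A).trace = A.trace

section SpectralCalculus

open scoped Matrix.Norms.L2Operator
open Filter Topology

variable {n : ℕ} {A B H K : Matrix (Fin n) (Fin n) ℂ} {g : ℝ → ℝ}

theorem posDef_iff_isHermitian_and_spectrum_subset :
    A.PosDef ↔ A.IsHermitian ∧ spectrum ℝ A ⊆ Set.Ioi 0 := by
  refine ⟨fun h ↦ ⟨h.1, ?_⟩, fun ⟨h, hs⟩ ↦ h.posDef_iff_eigenvalues_pos.2 fun i ↦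
    hs (h.eigenvalues_mem_spectrum_real i)⟩
  rw [h.1.spectrum_real_eq_range_eigenvalues]
  rintro _ ⟨i, rfl⟩
  exact h.eigenvalues_pos i

theorem isHermitian_add_real_smul (hA : A.IsHermitian) (hH : H.IsHermitian) (t : ℝ) :
    (A + t • H).IsHermitian :=
  IsSelfAdjoint.add hA (IsSelfAdjoint.smul (IsSelfAdjoint.all t) hH)

theorem exists_isCompact_eventually_spectrum_subset (hA : A.PosDef) (H : Matrix (Fin n) (Fin n) ℂ) :
    ∃ k ⊆ Set.Ioi (0 : ℝ), IsCompact k ∧ ∀ᶠ t : ℝ in 𝓝 0, spectrum ℝ (A + t • H) ⊆ k := by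
  have hs := (posDef_iff_isHermitian_and_spectrum_subset.1 hA).2
  have hc : IsCompact (spectrum ℝ A) := spectrum.isCompact A
  obtain ⟨k, ⟨hka, hk⟩, hks⟩ :=
    hc.nhdsSet_basis_isCompact.mem_iff.mp (isOpen_Ioi.mem_nhdsSet.2 hs)
  refine ⟨k, hks, hk, ?_⟩
  have hopen := (upperHemicontinuous_spectrum ℝ (Matrix (Fin n) (Fin n) ℂ)).isOpen k
  have hcont : Continuous fun t : ℝ ↦ A + t • H := by fun_prop
  have := (hopen.preimage hcont).mem_nhds (x := 0) (by simpa using hka)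
  filter_upwards [this] with t ht
  exact subset_of_mem_nhdsSet ht

theorem eventually_posDef_add_smul (hA : A.PosDef) (hH : H.IsHermitian) :
    ∀ᶠ t : ℝ in 𝓝 0, (A + t • H).PosDef := by
  obtain ⟨k, hk, -, h⟩ := exists_isCompact_eventually_spectrum_subset hA H
  filter_upwards [h] with t ht
  exact posDef_iff_isHermitian_and_spectrum_subset.2
    ⟨isHermitian_add_real_smul hA.1 hH t, ht.trans hk⟩

theorem tendsto_cfc_add_smul (hg : ContinuousOn g (Set.Ioi 0)) (hA : A.PosDef)
    (hH : H.IsHermitian) :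
    Tendsto (fun t : ℝ ↦ cfc g (A + t • H)) (𝓝 0) (𝓝 (cfc g A)) := by
  obtain ⟨k, hk, hkc, h⟩ := exists_isCompact_eventually_spectrum_subset hA H
  have hcont : ContinuousAt (fun t : ℝ ↦ A + t • H) 0 := by fun_prop
  have := hcont.cfc hkc g h
    (Eventually.of_forall fun t ↦ isHermitian_add_real_smul hA.1 hH t) (hg.mono hk)
  simpa [ContinuousAt] using this

theorem cfc_sub_smul_one_eq_cfc_dslope_mul (hg : ContinuousOn g (Set.Ioi 0)) {x : ℝ} (hx : 0 < x)
    (hgx : DifferentiableAt ℝ g x) (hB : B.PosDef) :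
    cfc g B - g x • 1 = cfc (dslope g x) B * (B - x • 1) := by
  obtain ⟨hBh, hs⟩ := posDef_iff_isHermitian_and_spectrum_subset.1 hB
  have hBs : IsSelfAdjoint B := hBh
  have hg' := hg.mono hs
  have hd : ContinuousOn (dslope g x) (spectrum ℝ B) :=
    ((continuousOn_dslope (isOpen_Ioi.mem_nhds hx)).2 ⟨hg, hgx⟩).mono hs
  have h1 : B - x • 1 = cfc (fun y : ℝ ↦ y - x) B := by
    rw [cfc_sub (fun y : ℝ ↦ y) (fun _ ↦ x), cfc_id' ℝ B, cfc_const x B,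
      Algebra.algebraMap_eq_smul_one]
  have h2 : cfc g B - g x • 1 = cfc (fun y : ℝ ↦ g y - g x) B := by
    rw [cfc_sub g (fun _ ↦ g x) B hg', cfc_const (g x) B, Algebra.algebraMap_eq_smul_one]
  rw [h1, h2, ← cfc_mul (dslope g x) (fun y : ℝ ↦ y - x) B hd]
  congr 1
  ext y
  rw [mul_comm, ← smul_eq_mul, sub_smul_dslope]

theorem cfc_eq_conj_diagonal (hA : A.IsHermitian) (g : ℝ → ℝ) :
    cfc g A = (hA.eigenvectorUnitary : Matrix (Fin n) (Fin n) ℂ) *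
      Matrix.diagonal (fun i ↦ (g (hA.eigenvalues i) : ℂ)) *
      star (hA.eigenvectorUnitary : Matrix (Fin n) (Fin n) ℂ) := by
  rw [hA.cfc_eq]
  simp [Matrix.IsHermitian.cfc, Unitary.conjStarAlgAut_apply, Function.comp_def]

theorem cfc_mul_eigenvectorUnitary (hA : A.IsHermitian) (g : ℝ → ℝ) :
    cfc g A * (hA.eigenvectorUnitary : Matrix (Fin n) (Fin n) ℂ) =
      (hA.eigenvectorUnitary : Matrix (Fin n) (Fin n) ℂ) *
      Matrix.diagonal (fun i ↦ (g (hA.eigenvalues i) : ℂ)) := by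
  rw [cfc_eq_conj_diagonal hA, mul_assoc, Unitary.coe_star_mul_self, mul_one]

theorem trFn_eq_re_trace_cfc (hA : A.IsHermitian) (f : ℝ → ℝ) :
    trFn f A = (Matrix.trace (cfc f A)).re := by
  rw [trFn, dif_pos hA, cfc_eq_conj_diagonal hA, Matrix.trace_mul_comm, ← mul_assoc,
    Unitary.coe_star_mul_self, one_mul]
  simp [Matrix.trace]

theorem divDiff_eq_dslope (g : ℝ → ℝ) (x y : ℝ) : divDiff g x y = dslope g y x := by
  rw [divDiff]
  split_ifs with h
  · rw [h, dslope_same]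
  · rw [dslope_of_ne _ h, slope_def_field]

theorem divDiff_comm (g : ℝ → ℝ) (x y : ℝ) : divDiff g x y = divDiff g y x := by
  rcases eq_or_ne x y with rfl | h
  · rfl
  · rw [divDiff_eq_dslope, divDiff_eq_dslope, dslope_of_ne _ h, dslope_of_ne _ h.symm, slope_comm]

/-- The Löwner matrix of `g` in an eigenbasis of `A`. -/
def loewnerMatrix (g : ℝ → ℝ) (hA : A.IsHermitian) : Matrix (Fin n) (Fin n) ℂ :=
  Matrix.of fun i j ↦ (divDiff g (hA.eigenvalues i) (hA.eigenvalues j) : ℂ)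

theorem frechetDiff_apply (hA : A.IsHermitian) (g : ℝ → ℝ) (H : Matrix (Fin n) (Fin n) ℂ) :
    frechetDiff g A H = (hA.eigenvectorUnitary : Matrix (Fin n) (Fin n) ℂ) *
      (loewnerMatrix g hA ⊙ (star (hA.eigenvectorUnitary : Matrix (Fin n) (Fin n) ℂ) * H *
        (hA.eigenvectorUnitary : Matrix (Fin n) (Fin n) ℂ))) *
      star (hA.eigenvectorUnitary : Matrix (Fin n) (Fin n) ℂ) := by
  rw [frechetDiff, dif_pos hA]
  simp [conjEnd, hadamardEnd, loewnerMatrix, mul_assoc]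

/-- The matrix whose `j`-th column is that of `g[B, λⱼ] H U`, where `λ` and `U` diagonalise `A`. -/
def loewnerColumns (g : ℝ → ℝ) (hA : A.IsHermitian) (B H : Matrix (Fin n) (Fin n) ℂ) :
    Matrix (Fin n) (Fin n) ℂ :=
  Matrix.of fun i j ↦ (cfc (dslope g (hA.eigenvalues j)) B *
    (H * (hA.eigenvectorUnitary : Matrix (Fin n) (Fin n) ℂ))) i j

theorem loewnerColumns_self (hA : A.IsHermitian) (g : ℝ → ℝ) (H : Matrix (Fin n) (Fin n) ℂ) :
    loewnerColumns g hA A H =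
      frechetDiff g A H * (hA.eigenvectorUnitary : Matrix (Fin n) (Fin n) ℂ) := by
  rw [frechetDiff_apply hA, mul_assoc _ (star _), Unitary.coe_star_mul_self, mul_one]
  ext i j
  rw [loewnerColumns, Matrix.of_apply, cfc_eq_conj_diagonal hA, mul_assoc, mul_assoc,
    Matrix.mul_apply, Matrix.mul_apply]
  refine Finset.sum_congr rfl fun k _ ↦ ?_
  rw [Matrix.diagonal_mul, Matrix.hadamard_apply, loewnerMatrix, Matrix.of_apply,
    divDiff_eq_dslope, mul_assoc (star _)]

theorem cfc_sub_cfc_mul_eigenvectorUnitary (hg : DifferentiableOn ℝ g (Set.Ioi 0))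
    (hA : A.PosDef) (hB : B.PosDef) :
    (cfc g B - cfc g A) * (hA.1.eigenvectorUnitary : Matrix (Fin n) (Fin n) ℂ) =
      loewnerColumns g hA.1 B (B - A) := by
  set U := (hA.1.eigenvectorUnitary : Matrix (Fin n) (Fin n) ℂ) with hU
  have hAU : A * U = U * Matrix.diagonal (fun i ↦ (hA.1.eigenvalues i : ℂ)) := by
    have := cfc_mul_eigenvectorUnitary hA.1 id
    rwa [cfc_id ℝ A (show IsSelfAdjoint A from hA.1)] at this
  ext i j
  have hpos := hA.eigenvalues_pos j
  have hcol : ∀ k, ((B - hA.1.eigenvalues j • 1) * U) k j = ((B - A) * U) k j := fun k ↦ by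
    rw [sub_mul, sub_mul, hAU, Matrix.sub_apply, Matrix.sub_apply, Matrix.mul_diagonal]
    simp [mul_comm]
  have h1 : ((cfc g B - cfc g A) * U) i j = ((cfc g B - g (hA.1.eigenvalues j) • 1) * U) i j := by
    rw [sub_mul, sub_mul, cfc_mul_eigenvectorUnitary hA.1, Matrix.sub_apply, Matrix.sub_apply,
      Matrix.mul_diagonal]
    simp [mul_comm, hU]
  rw [h1, cfc_sub_smul_one_eq_cfc_dslope_mul hg.continuousOn hpos
    (hg.differentiableAt (isOpen_Ioi.mem_nhds hpos)) hB, mul_assoc, loewnerColumns,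
    Matrix.of_apply, Matrix.mul_apply, Matrix.mul_apply]
  exact Finset.sum_congr rfl fun k _ ↦ by rw [hcol]

theorem hasDerivAt_re_trace_cfc_mul (hg : DifferentiableOn ℝ g (Set.Ioi 0))
    (hA : A.PosDef) (hH : H.IsHermitian) (K : Matrix (Fin n) (Fin n) ℂ) :
    HasDerivAt (fun t : ℝ ↦ (Matrix.trace (cfc g (A + t • H) * K)).re)
      (Matrix.trace (frechetDiff g A H * K)).re 0 := by
  set U := (hA.1.eigenvectorUnitary : Matrix (Fin n) (Fin n) ℂ) with hU
  have hUU (X : Matrix (Fin n) (Fin n) ℂ) : X * K = X * U * (star U * K) := by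
    have hUs : U * star U = 1 := Unitary.coe_mul_star_self _
    rw [mul_assoc, ← mul_assoc U, hUs, one_mul]
  have hcols : Tendsto (fun t : ℝ ↦ loewnerColumns g hA.1 (A + t • H) H) (𝓝 0)
      (𝓝 (loewnerColumns g hA.1 A H)) := by
    refine tendsto_pi_nhds.2 fun i ↦ tendsto_pi_nhds.2 fun j ↦ ?_
    have hpos := hA.eigenvalues_pos j
    have hd : ContinuousOn (dslope g (hA.1.eigenvalues j)) (Set.Ioi 0) :=
      (continuousOn_dslope (isOpen_Ioi.mem_nhds hpos)).2
        ⟨hg.continuousOn, hg.differentiableAt (isOpen_Ioi.mem_nhds hpos)⟩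
    have := (tendsto_cfc_add_smul hd hA hH).mul_const (H * U)
    exact (tendsto_pi_nhds.1 (tendsto_pi_nhds.1 this i) j)
  have hlim : Tendsto
      (fun t : ℝ ↦ (Matrix.trace (loewnerColumns g hA.1 (A + t • H) H * (star U * K))).re) (𝓝 0)
      (𝓝 (Matrix.trace (loewnerColumns g hA.1 A H * (star U * K))).re) := by
    have hc : Continuous fun X : Matrix (Fin n) (Fin n) ℂ ↦ (Matrix.trace (X * (star U * K))).re :=
      Complex.continuous_re.comp (Continuous.matrix_trace (by fun_prop))
    exact (hc.tendsto _).comp hcols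
  rw [hasDerivAt_iff_tendsto_slope, hUU, ← loewnerColumns_self]
  refine (hlim.mono_left nhdsWithin_le_nhds).congr' ?_
  filter_upwards [(eventually_posDef_add_smul hA hH).filter_mono nhdsWithin_le_nhds,
    self_mem_nhdsWithin] with t ht ht0
  have hsmul : loewnerColumns g hA.1 (A + t • H) (t • H) =
      t • loewnerColumns g hA.1 (A + t • H) H := by
    ext i j
    simp [loewnerColumns]
  have key := cfc_sub_cfc_mul_eigenvectorUnitary hg hA ht
  rw [add_sub_cancel_left, hsmul] at key
  have ht0' : t ≠ 0 := ht0
  rw [slope_def_field, zero_smul, add_zero, ← Complex.sub_re, ← Matrix.trace_sub, ← sub_mul,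
    hUU (_ - _), key, sub_zero, Matrix.smul_mul, Matrix.trace_smul, Complex.smul_re, smul_eq_mul]
  field_simp

theorem trace_frechetDiff (hA : A.IsHermitian) (g : ℝ → ℝ) (H : Matrix (Fin n) (Fin n) ℂ) :
    Matrix.trace (frechetDiff g A H) = Matrix.trace (cfc (deriv g) A * H) := by
  rw [frechetDiff_apply hA, cfc_eq_conj_diagonal hA, Matrix.trace_mul_comm, ← mul_assoc,
    Unitary.coe_star_mul_self, one_mul, mul_assoc (_ * _) (star _) H,
    mul_assoc (hA.eigenvectorUnitary : Matrix (Fin n) (Fin n) ℂ) (Matrix.diagonal _),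
    Matrix.trace_mul_comm (hA.eigenvectorUnitary : Matrix (Fin n) (Fin n) ℂ), mul_assoc,
    mul_assoc (Matrix.diagonal _), mul_assoc (star _) H]
  simp [Matrix.trace, loewnerMatrix, divDiff]

theorem trace_mul_frechetDiff (hA : A.IsHermitian) (g : ℝ → ℝ) (X Y : Matrix (Fin n) (Fin n) ℂ) :
    Matrix.trace (X * frechetDiff g A Y) =
      Matrix.trace ((star (hA.eigenvectorUnitary : Matrix (Fin n) (Fin n) ℂ) * X *
          (hA.eigenvectorUnitary : Matrix (Fin n) (Fin n) ℂ)) *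
        (loewnerMatrix g hA ⊙ (star (hA.eigenvectorUnitary : Matrix (Fin n) (Fin n) ℂ) * Y *
          (hA.eigenvectorUnitary : Matrix (Fin n) (Fin n) ℂ)))) := by
  rw [frechetDiff_apply hA, ← mul_assoc, Matrix.trace_mul_comm, ← mul_assoc, ← mul_assoc]

theorem trace_mul_frechetDiff_comm (hA : A.IsHermitian) (g : ℝ → ℝ)
    (X Y : Matrix (Fin n) (Fin n) ℂ) :
    Matrix.trace (X * frechetDiff g A Y) = Matrix.trace (Y * frechetDiff g A X) := by
  rw [trace_mul_frechetDiff hA, trace_mul_frechetDiff hA]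
  generalize star (hA.eigenvectorUnitary : Matrix (Fin n) (Fin n) ℂ) * X *
    (hA.eigenvectorUnitary : Matrix (Fin n) (Fin n) ℂ) = P
  generalize star (hA.eigenvectorUnitary : Matrix (Fin n) (Fin n) ℂ) * Y *
    (hA.eigenvectorUnitary : Matrix (Fin n) (Fin n) ℂ) = Q
  simp only [Matrix.trace, Matrix.diag_apply, Matrix.mul_apply, Matrix.hadamard_apply,
    loewnerMatrix, Matrix.of_apply]
  rw [Finset.sum_comm]
  refine Finset.sum_congr rfl fun i _ ↦ Finset.sum_congr rfl fun j _ ↦ ?_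
  rw [divDiff_comm]
  ring

theorem isHermitian_frechetDiff (hA : A.IsHermitian) (g : ℝ → ℝ) (hH : H.IsHermitian) :
    (frechetDiff g A H).IsHermitian := by
  rw [frechetDiff_apply hA]
  refine Matrix.isHermitian_mul_mul_conjTranspose _ (Matrix.IsHermitian.ext fun i j ↦ ?_)
  have hU := (Matrix.isHermitian_conjTranspose_mul_mul
    (hA.eigenvectorUnitary : Matrix (Fin n) (Fin n) ℂ) hH).apply i j
  rw [Matrix.hadamard_apply, Matrix.hadamard_apply, star_mul', Matrix.star_eq_conjTranspose, hU,
    loewnerMatrix, Matrix.of_apply, Matrix.of_apply, divDiff_comm]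
  simp

theorem trace_mul_frechetDiff_self_eq_re (hA : A.IsHermitian) (g : ℝ → ℝ) (hH : H.IsHermitian) :
    Matrix.trace (H * frechetDiff g A H) = ((Matrix.trace (H * frechetDiff g A H)).re : ℂ) := by
  refine (Complex.conj_eq_iff_re.1 ?_).symm
  rw [starRingEnd_apply, ← Matrix.trace_conjTranspose, Matrix.conjTranspose_mul,
    (isHermitian_frechetDiff hA g hH).eq, hH.eq, Matrix.trace_mul_comm]

theorem trace_star_mul_frechetDiff_add_I_smul (hA : A.IsHermitian) (g : ℝ → ℝ)
    {X Y : Matrix (Fin n) (Fin n) ℂ} (hX : X.IsHermitian) (hY : Y.IsHermitian) :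
    Matrix.trace (star (X + Complex.I • Y) * frechetDiff g A (X + Complex.I • Y)) =
      Matrix.trace (X * frechetDiff g A X) + Matrix.trace (Y * frechetDiff g A Y) := by
  have hX' : star X = X := hX
  have hY' : star Y = Y := hY
  rw [star_add, star_smul, hX', hY', map_add, map_smul]
  simp only [add_mul, mul_add, Matrix.trace_add, Matrix.smul_mul, Matrix.mul_smul,
    Matrix.trace_smul, smul_eq_mul, Complex.star_def, Complex.conj_I]
  rw [trace_mul_frechetDiff_comm hA g Y X]
  linear_combination (-Matrix.trace (Y * frechetDiff g A Y)) * Complex.I_mul_I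

theorem isHermitian_of_posDef_add_smul {t : ℝ} (hA : (A + t • H).PosDef) (hH : H.IsHermitian) :
    A.IsHermitian := by
  simpa using isHermitian_add_real_smul hA.1 hH (-t)

theorem hasDerivAt_re_trace_cfc_line (hg : DifferentiableOn ℝ g (Set.Ioi 0)) {t : ℝ}
    (hA : (A + t • H).PosDef) (hH : H.IsHermitian) (K : Matrix (Fin n) (Fin n) ℂ) :
    HasDerivAt (fun s : ℝ ↦ (Matrix.trace (cfc g (A + s • H) * K)).re)
      (Matrix.trace (frechetDiff g (A + t • H) H * K)).re t := by
  have h := hasDerivAt_re_trace_cfc_mul hg hA hH K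
  rw [← sub_self t] at h
  refine (h.comp_sub_const t t).congr_of_eventuallyEq (Eventually.of_forall fun s ↦ ?_)
  simp only [add_assoc, ← add_smul, add_sub_cancel]

theorem hasDerivAt_trFn_line (hg : DifferentiableOn ℝ g (Set.Ioi 0)) {t : ℝ}
    (hA : (A + t • H).PosDef) (hH : H.IsHermitian) :
    HasDerivAt (fun s : ℝ ↦ trFn g (A + s • H))
      (Matrix.trace (cfc (deriv g) (A + t • H) * H)).re t := by
  have h := hasDerivAt_re_trace_cfc_line hg hA hH 1
  rw [mul_one, trace_frechetDiff hA.1] at h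
  refine h.congr_of_eventuallyEq (Eventually.of_forall fun s ↦ ?_)
  simp only [mul_one]
  exact trFn_eq_re_trace_cfc
    (isHermitian_add_real_smul (isHermitian_of_posDef_add_smul hA hH) hH s) g

theorem hasDerivAt_re_trace_cfc_line_self (hg : DifferentiableOn ℝ g (Set.Ioi 0)) {t : ℝ}
    (hA : (A + t • H).PosDef) (hH : H.IsHermitian) :
    HasDerivAt (fun s : ℝ ↦ (Matrix.trace (cfc g (A + s • H) * H)).re)
      (Matrix.trace (H * frechetDiff g (A + t • H) H)).re t := by
  rw [Matrix.trace_mul_comm]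
  exact hasDerivAt_re_trace_cfc_line hg hA hH H

end SpectralCalculus

section ConvexityOnLines

open Filter Topology

theorem convexOn_iff_forall_hasDerivAt_nonneg {T : Set ℝ} (hT : IsOpen T) (hTc : Convex ℝ T)
    {φ φ' φ'' : ℝ → ℝ} (h1 : ∀ t ∈ T, HasDerivAt φ (φ' t) t)
    (h2 : ∀ t ∈ T, HasDerivAt φ' (φ'' t) t) :
    ConvexOn ℝ T φ ↔ ∀ t ∈ T, 0 ≤ φ'' t := by
  refine ⟨fun hφ t ht ↦ ?_, fun h ↦ ?_⟩
  · have hmono : MonotoneOn φ' T := (hφ.monotoneOn_deriv fun x hx ↦ (h1 x hx).differentiableAt).congr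
      fun x hx ↦ (h1 x hx).deriv
    have := hmono.derivWithin_nonneg (x := t)
    rwa [(h2 t ht).hasDerivWithinAt.derivWithin (hT.uniqueDiffWithinAt ht)] at this
  · refine convexOn_of_hasDerivWithinAt2_nonneg hTc
      (fun t ht ↦ (h1 t ht).continuousAt.continuousWithinAt) (f' := φ') (f'' := φ'') ?_ ?_ ?_ <;>
    rw [hT.interior_eq]
    exacts [fun t ht ↦ (h1 t ht).hasDerivWithinAt, fun t ht ↦ (h2 t ht).hasDerivWithinAt, h]

variable {n : ℕ} {ρ σ a b : Matrix (Fin n) (Fin n) ℂ} {f : ℝ → ℝ}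

theorem convex_setOf_posDef_prod :
    Convex ℝ {p : Matrix (Fin n) (Fin n) ℂ × Matrix (Fin n) (Fin n) ℂ |
      p.1.PosDef ∧ p.2.PosDef} := by
  have h : Convex ℝ {A : Matrix (Fin n) (Fin n) ℂ | A.PosDef} :=
    convex_iff_forall_pos.2 fun A hA B hB s t hs ht _ ↦ (hA.smul hs).add (hB.smul ht)
  exact h.prod h

theorem isOpen_setOf_posDef_add_smul (ha : a.IsHermitian) :
    IsOpen {t : ℝ | (ρ + t • a).PosDef} := by
  refine isOpen_iff_mem_nhds.2 fun t ht ↦ ?_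
  have h := eventually_posDef_add_smul ht ha
  have hsub : Tendsto (fun s : ℝ ↦ s - t) (𝓝 t) (𝓝 0) := by
    simpa using (continuous_sub_right t).tendsto t
  filter_upwards [hsub.eventually h] with s hs
  simpa [add_assoc, ← add_smul] using hs

theorem convexOn_line_iff (hf : DifferentiableOn ℝ f (Set.Ioi 0))
    (hf' : DifferentiableOn ℝ (deriv f) (Set.Ioi 0)) (ha : a.IsHermitian) (hb : b.IsHermitian)
    (hc : Convex ℝ {t : ℝ | (ρ + t • a).PosDef ∧ (σ + t • b).PosDef}) :
    ConvexOn ℝ {t : ℝ | (ρ + t • a).PosDef ∧ (σ + t • b).PosDef}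
        (fun t ↦ - trFn f ((ρ + t • a) + (σ + t • b)) + trFn f (ρ + t • a) + trFn f (σ + t • b)) ↔
      ∀ t : ℝ, (ρ + t • a).PosDef → (σ + t • b).PosDef →
        (Matrix.trace ((a + b) *
          frechetDiff (deriv f) ((ρ + t • a) + (σ + t • b)) (a + b))).re ≤
        (Matrix.trace (a * frechetDiff (deriv f) (ρ + t • a) a)).re +
        (Matrix.trace (b * frechetDiff (deriv f) (σ + t • b) b)).re := by
  have hsum (t : ℝ) : (ρ + t • a) + (σ + t • b) = (ρ + σ) + t • (a + b) := by
    rw [smul_add]; abel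
  have hab : (a + b).IsHermitian := ha.add hb
  have hopen : IsOpen {t : ℝ | (ρ + t • a).PosDef ∧ (σ + t • b).PosDef} :=
    (isOpen_setOf_posDef_add_smul ha).inter (isOpen_setOf_posDef_add_smul hb)
  simp only [hsum]
  rw [convexOn_iff_forall_hasDerivAt_nonneg hopen hc
    (φ' := fun t ↦ - (Matrix.trace (cfc (deriv f) ((ρ + σ) + t • (a + b)) * (a + b))).re +
      (Matrix.trace (cfc (deriv f) (ρ + t • a) * a)).re +
      (Matrix.trace (cfc (deriv f) (σ + t • b) * b)).re)
    (φ'' := fun t ↦ - (Matrix.trace ((a + b) *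
        frechetDiff (deriv f) ((ρ + σ) + t • (a + b)) (a + b))).re +
      (Matrix.trace (a * frechetDiff (deriv f) (ρ + t • a) a)).re +
      (Matrix.trace (b * frechetDiff (deriv f) (σ + t • b) b)).re)]
  · refine forall_congr' fun t ↦ ⟨fun h h1 h2 ↦ ?_, fun h ⟨h1, h2⟩ ↦ ?_⟩
    · linarith [h ⟨h1, h2⟩]
    · linarith [h h1 h2]
  · rintro t ⟨h1, h2⟩
    exact ((hasDerivAt_trFn_line hf (hsum t ▸ h1.add h2) hab).neg.add
      (hasDerivAt_trFn_line hf h1 ha)).add (hasDerivAt_trFn_line hf h2 hb)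
  · rintro t ⟨h1, h2⟩
    exact ((hasDerivAt_re_trace_cfc_line_self hf' (hsum t ▸ h1.add h2) hab).neg.add
      (hasDerivAt_re_trace_cfc_line_self hf' h1 ha)).add
      (hasDerivAt_re_trace_cfc_line_self hf' h2 hb)

theorem convexOn_trFn_iff_forall_isHermitian (hf : DifferentiableOn ℝ f (Set.Ioi 0))
    (hf' : DifferentiableOn ℝ (deriv f) (Set.Ioi 0)) :
    ConvexOn ℝ {p : Matrix (Fin n) (Fin n) ℂ × Matrix (Fin n) (Fin n) ℂ |
          p.1.PosDef ∧ p.2.PosDef}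
        (fun p => - trFn f (p.1 + p.2) + trFn f p.1 + trFn f p.2) ↔
      ∀ ρ σ a b : Matrix (Fin n) (Fin n) ℂ, ρ.PosDef → σ.PosDef → a.IsHermitian → b.IsHermitian →
        (Matrix.trace ((a + b) * frechetDiff (deriv f) (ρ + σ) (a + b))).re ≤
        (Matrix.trace (a * frechetDiff (deriv f) ρ a)).re +
        (Matrix.trace (b * frechetDiff (deriv f) σ b)).re := by
  have hline (ρ σ a b : Matrix (Fin n) (Fin n) ℂ) (t : ℝ) :
      AffineMap.lineMap (ρ, σ) (ρ + a, σ + b) t = (ρ + t • a, σ + t • b) := by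
    simp [AffineMap.lineMap_apply, add_comm]
  have hpre (ρ σ a b : Matrix (Fin n) (Fin n) ℂ) :
      (AffineMap.lineMap (ρ, σ) (ρ + a, σ + b) : ℝ →ᵃ[ℝ] _) ⁻¹'
        {p : Matrix (Fin n) (Fin n) ℂ × Matrix (Fin n) (Fin n) ℂ | p.1.PosDef ∧ p.2.PosDef} =
      {t : ℝ | (ρ + t • a).PosDef ∧ (σ + t • b).PosDef} := by
    ext t
    simp only [Set.mem_preimage, hline, Set.mem_ofPred_eq]
  have hconv (ρ σ a b : Matrix (Fin n) (Fin n) ℂ) :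
      Convex ℝ {t : ℝ | (ρ + t • a).PosDef ∧ (σ + t • b).PosDef} :=
    hpre ρ σ a b ▸ convex_setOf_posDef_prod.affine_preimage _
  constructor
  · intro h ρ σ a b hρ hσ ha hb
    have hl := h.comp_affineMap (AffineMap.lineMap (ρ, σ) (ρ + a, σ + b))
    simp only [hpre, Function.comp_def, hline] at hl
    simpa using (convexOn_line_iff hf hf' ha hb (hconv ρ σ a b)).1 hl 0 (by simpa) (by simpa)
  · intro h
    refine ⟨convex_setOf_posDef_prod, ?_⟩
    rintro ⟨ρ, σ⟩ ⟨hρ, hσ⟩ ⟨ρ', σ'⟩ ⟨hρ', hσ'⟩ s t hs ht hst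
    obtain ⟨a, rfl⟩ : ∃ a, ρ' = ρ + a := ⟨ρ' - ρ, by abel⟩
    obtain ⟨b, rfl⟩ : ∃ b, σ' = σ + b := ⟨σ' - σ, by abel⟩
    have ha : a.IsHermitian := by simpa using hρ'.1.sub hρ.1
    have hb : b.IsHermitian := by simpa using hσ'.1.sub hσ.1
    have key := ((convexOn_line_iff hf hf' ha hb (hconv ρ σ a b)).2
      fun t h1 h2 ↦ h _ _ a b h1 h2 ha hb).2 (x := 0) (y := 1)
      ⟨by simpa using hρ, by simpa using hσ⟩ ⟨by simpa using hρ', by simpa using hσ'⟩ hs ht hst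
    have hcomb (X Y : Matrix (Fin n) (Fin n) ℂ) : s • X + t • (X + Y) = X + t • Y := by
      rw [smul_add, ← add_assoc, ← add_smul, hst, one_smul]
    simpa [hcomb, -smul_add] using key

end ConvexityOnLines

/-- For twice continuously differentiable `f` with `f'' > 0`, convexity of
`G(ρ,σ) = -Tr f(ρ+σ) + Tr f(ρ) + Tr f(σ)` in positive definite `ρ, σ` is equivalent to
`Tr (a+b)* df'(ρ+σ) (a+b) ≤ Tr a* df'(ρ) a + Tr b* df'(σ) b` for all operators `a, b`. -/
theorem order_two_convexity_iff_trace_inequality (f : ℝ → ℝ)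
    (hf : ContDiffOn ℝ 2 f (Set.Ioi 0))
    (hf'' : ∀ t > (0 : ℝ), 0 < deriv (deriv f) t) :
    (∀ n : ℕ,
      ConvexOn ℝ
        {p : Matrix (Fin n) (Fin n) ℂ × Matrix (Fin n) (Fin n) ℂ |
          p.1.PosDef ∧ p.2.PosDef}
        (fun p => - trFn f (p.1 + p.2) + trFn f p.1 + trFn f p.2)) ↔
    (∀ n : ℕ, ∀ ρ σ a b : Matrix (Fin n) (Fin n) ℂ, ρ.PosDef → σ.PosDef →
      Matrix.trace (star (a + b) * frechetDiff (deriv f) (ρ + σ) (a + b)) ≤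
        Matrix.trace (star a * frechetDiff (deriv f) ρ a) +
        Matrix.trace (star b * frechetDiff (deriv f) σ b)) := by
  have hdiff : DifferentiableOn ℝ f (Set.Ioi 0) := hf.differentiableOn (by norm_num)
  have hdiff' : DifferentiableOn ℝ (deriv f) (Set.Ioi 0) :=
    ((contDiffOn_succ_iff_deriv_of_isOpen (n := 1) isOpen_Ioi).1
      (by simpa [one_add_one_eq_two] using hf)).2.2.differentiableOn one_ne_zero
  refine forall_congr' fun n ↦ (convexOn_trFn_iff_forall_isHermitian hdiff hdiff').trans ?_
  constructor
  · intro h ρ σ a b hρ hσ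
    have hre (x : Matrix (Fin n) (Fin n) ℂ) : (realPart x : Matrix (Fin n) (Fin n) ℂ).IsHermitian :=
      (realPart x).2
    have him (x : Matrix (Fin n) (Fin n) ℂ) :
        (imaginaryPart x : Matrix (Fin n) (Fin n) ℂ).IsHermitian :=
      (imaginaryPart x).2
    rw [← realPart_add_I_smul_imaginaryPart a, ← realPart_add_I_smul_imaginaryPart b,
      add_add_add_comm, ← smul_add,
      trace_star_mul_frechetDiff_add_I_smul (hρ.add hσ).1 _ ((hre a).add (hre b))
        ((him a).add (him b)),
      trace_star_mul_frechetDiff_add_I_smul hρ.1 _ (hre a) (him a),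
      trace_star_mul_frechetDiff_add_I_smul hσ.1 _ (hre b) (him b),
      trace_mul_frechetDiff_self_eq_re (hρ.add hσ).1 _ ((hre a).add (hre b)),
      trace_mul_frechetDiff_self_eq_re (hρ.add hσ).1 _ ((him a).add (him b)),
      trace_mul_frechetDiff_self_eq_re hρ.1 _ (hre a),
      trace_mul_frechetDiff_self_eq_re hρ.1 _ (him a),
      trace_mul_frechetDiff_self_eq_re hσ.1 _ (hre b),
      trace_mul_frechetDiff_self_eq_re hσ.1 _ (him b)]
    rw [← Complex.ofReal_add, ← Complex.ofReal_add, ← Complex.ofReal_add, ← Complex.ofReal_add,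
      Complex.real_le_real]
    linarith [h ρ σ _ _ hρ hσ (hre a) (hre b), h ρ σ _ _ hρ hσ (him a) (him b)]
  · intro h ρ σ a b hρ hσ ha hb
    have hab : star (a + b) = a + b := ha.add hb
    have ha' : star a = a := ha
    have hb' : star b = b := hb
    have key := h ρ σ a b hρ hσ
    rw [hab, ha', hb'] at key
    simpa using (Complex.le_def.1 key).1

end
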